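/- arXiv:2511.13930 — 9 statements merged into one kernel-verified Lean document; each statement's English description precedes it below -/
import Mathlib

section
/- Let D ≥ 1 be an odd integer and R ≥ 0 an integer. Set k = 2 if D ≡ 3 (mod 6) and k = 0 otherwise. Then the quadruple (0, 1, D/2, (D²−k)/6) is a numerical wall datum for (D,0,R). Consequently there is a numerical wall datum for (D,0,R) whose value 6e/c equals D²−k, and in particular √(6e/c) = √(D²−k) > D−1. -/
noncomputable section

/-- A real number is an integer. -/
def IsIntR (x : ℝ) : Prop := ∃ n : ℤ, x = n

/-- `(a₀,a₁,a₂,a₃)` is a ℙ³-character: the integrality constraints satisfied by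
Chern characters of objects of `D^b(ℙ³)`. -/
def IsP3Char (a₀ a₁ a₂ a₃ : ℝ) : Prop :=
  IsIntR a₀ ∧ IsIntR a₁ ∧ IsIntR (a₂ - a₁ ^ 2 / 2) ∧ IsIntR (a₃ - a₁ / 6) ∧
    IsIntR (2 * a₃ - a₁ * a₂ + a₁ ^ 3 / 6)

/-- `(r,c,d,e)` is the β-twist of `(a₀,a₁,a₂,a₃)`. -/
def IsTwist (β r c d e a₀ a₁ a₂ a₃ : ℝ) : Prop :=
  r = a₀ ∧ c = a₁ - β * a₀ ∧ d = a₂ - β * a₁ + β ^ 2 / 2 * a₀ ∧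
    e = a₃ - β * a₂ + β ^ 2 / 2 * a₁ - β ^ 3 / 6 * a₀

/-- `(r,c,d,e)` is a numerical wall datum for `(D, β, R)`:  it is the β-twist of some
ℙ³-character, `c > 0`, and conditions (N1), (N2), (N3) hold. -/
def IsWallDatum (D : ℤ) (β : ℝ) (R : ℤ) (r c d e : ℝ) : Prop :=
  (∃ a₀ a₁ a₂ a₃ : ℝ, IsP3Char a₀ a₁ a₂ a₃ ∧ IsTwist β r c d e a₀ a₁ a₂ a₃) ∧
  0 < c ∧
  (0 < 2 * d ∧ 2 * d < 2 * (D : ℝ)) ∧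
  (0 < c * (6 * e) ∧ c * (6 * e) ≤ min (4 * d ^ 2) (4 * ((D : ℝ) - d) ^ 2)) ∧
  (-(c * (2 * (D : ℝ) - 2 * d)) / (6 * e) - (R : ℝ) ≤ r ∧ r ≤ c * (2 * d) / (6 * e))

/-- The rank-zero quadruple `(0, 1, D/2, (D² - k)/6)` is an untwisted wall datum as soon as the two
integrality constraints on `a₃` and the bound `k < D²` hold. -/
theorem isWallDatum_zero_one {D R m n : ℤ} {k : ℝ} (hD : 1 ≤ D) (hodd : Odd D) (hR : 0 ≤ R)
    (hk : 0 ≤ k) (hkD : k < (D : ℝ) ^ 2) (hm : (D : ℝ) ^ 2 - k - 1 = 6 * m)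
    (hn : 2 * ((D : ℝ) ^ 2 - k) - 3 * D + 1 = 6 * n) :
    IsWallDatum D 0 R 0 1 ((D : ℝ) / 2) (((D : ℝ) ^ 2 - k) / 6) := by
  have hD' : (1 : ℝ) ≤ D := by exact_mod_cast hD
  have hR' : (0 : ℝ) ≤ R := by exact_mod_cast hR
  have he : 6 * (((D : ℝ) ^ 2 - k) / 6) = (D : ℝ) ^ 2 - k := by ring
  have hpos : 0 < (D : ℝ) ^ 2 - k := by linarith
  refine ⟨⟨0, 1, D / 2, ((D : ℝ) ^ 2 - k) / 6, ⟨⟨0, by simp⟩, ⟨1, by simp⟩, ?_, ⟨m, ?_⟩, ⟨n, ?_⟩⟩,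
    by simp [IsTwist]⟩, one_pos, ⟨by linarith, by linarith⟩, ?_, ?_⟩
  · obtain ⟨j, rfl⟩ := hodd
    exact ⟨j, by push_cast; ring⟩
  · linarith
  · linarith
  · rw [he]
    exact ⟨by linarith, le_min (by nlinarith) (by nlinarith)⟩
  · rw [he]
    refine ⟨?_, by positivity⟩
    have h : 0 ≤ 1 * (2 * (D : ℝ) - 2 * (D / 2)) / ((D : ℝ) ^ 2 - k) :=
      div_nonneg (by linarith) hpos.le
    rw [neg_div]
    linarith

/-- The correction term `k` of an odd `D`: nonnegative, small compared to `D`, and making the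
quadruple `(0, 1, D/2, (D² - k)/6)` integral. -/
theorem exists_integrality_of_odd {D : ℤ} (hD : 1 ≤ D) (hodd : Odd D) :
    ∃ k m n : ℤ, (if D % 6 = 3 then (2 : ℝ) else 0) = k ∧ 0 ≤ k ∧ k < 2 * D - 1 ∧
      D ^ 2 - k - 1 = 6 * m ∧ 2 * (D ^ 2 - k) - 3 * D + 1 = 6 * n := by
  obtain ⟨q, hq⟩ : ∃ q, D = 6 * q + D % 6 := ⟨D / 6, by omega⟩
  have h : D % 6 = 1 ∨ D % 6 = 3 ∨ D % 6 = 5 := by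
    have := Int.odd_iff.mp hodd
    omega
  rcases h with h | h | h <;> rw [h] at hq
  · exact ⟨0, 6 * q ^ 2 + 2 * q, 12 * q ^ 2 + q, by simp [h], le_rfl, by omega,
      by rw [hq]; ring, by rw [hq]; ring⟩
  · exact ⟨2, 6 * q ^ 2 + 6 * q + 1, 12 * q ^ 2 + 9 * q + 1, by simp [h], by norm_num, by omega,
      by rw [hq]; ring, by rw [hq]; ring⟩
  · exact ⟨0, 6 * q ^ 2 + 10 * q + 4, 12 * q ^ 2 + 17 * q + 6, by simp [h], le_rfl, by omega,
      by rw [hq]; ring, by rw [hq]; ring⟩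

theorem stmt1 (D R : ℤ) (hD : 1 ≤ D) (hodd : Odd D) (hR : 0 ≤ R) :
    IsWallDatum D 0 R 0 1 ((D : ℝ) / 2)
        (((D : ℝ) ^ 2 - (if D % 6 = 3 then (2 : ℝ) else 0)) / 6) ∧
      (∃ r c d e : ℝ, IsWallDatum D 0 R r c d e ∧
        6 * e / c = (D : ℝ) ^ 2 - (if D % 6 = 3 then (2 : ℝ) else 0)) ∧
      Real.sqrt ((D : ℝ) ^ 2 - (if D % 6 = 3 then (2 : ℝ) else 0)) > (D : ℝ) - 1 := by
  obtain ⟨k, m, n, hk, hk0, hkD, hm, hn⟩ := exists_integrality_of_odd hD hodd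
  rw [hk]
  have hD' : (1 : ℝ) ≤ D := by exact_mod_cast hD
  have hk0' : (0 : ℝ) ≤ k := by exact_mod_cast hk0
  have hkD' : (k : ℝ) < 2 * D - 1 := by exact_mod_cast hkD
  have hwall := isWallDatum_zero_one hD hodd hR hk0' (by nlinarith [sq_nonneg ((D : ℝ) - 1)])
    (by exact_mod_cast hm) (by exact_mod_cast hn)
  exact ⟨hwall, ⟨_, _, _, _, hwall, by ring⟩, Real.lt_sqrt_of_sq_lt (by linarith)⟩
end
end

section
/- Let D ≥ 1 and R ≥ 0 be integers. Every numerical wall datum (r,c,d,e) for (D,0,R) satisfies 6e/c ≤ D², i.e., every numerical wall at β = 0 for the Chern character (−R,0,D,0) satisfies α₀ = √(6e/c) ≤ D. (In particular, for R = 0 there are no numerical walls for (0,0,D,0) in the region (s+1/6)α² > D²/6 of the (α,s)-slice, which therefore lies in the Gieseker chamber.) -/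
noncomputable section

theorem stmt2 (D R : ℤ) (hD : 1 ≤ D) (hR : 0 ≤ R) (r c d e : ℝ)
    (h : IsWallDatum D 0 R r c d e) :
    6 * e / c ≤ (D : ℝ) ^ 2 := by
  obtain ⟨⟨a₀, a₁, a₂, a₃, ⟨-, ⟨n, hn⟩, -⟩, -, hca, -⟩, hc, ⟨hd, hdD⟩, ⟨-, hmin⟩, -⟩ := h
  obtain ⟨hd_sq, hDd_sq⟩ := le_min_iff.mp hmin
  have hcn : c = n := by rw [hca, hn]; ring
  have hc_one : 1 ≤ c := by
    rw [hcn] at hc ⊢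
    exact_mod_cast hc
  have hce : c * (6 * e) ≤ (D : ℝ) ^ 2 := by
    rcases le_total (2 * d) D with hle | hle
    · nlinarith
    · nlinarith
  have hc_sq : 1 ≤ c ^ 2 := one_le_pow₀ hc_one
  rw [div_le_iff₀ hc]
  refine le_of_mul_le_mul_left ?_ hc
  nlinarith [mul_le_mul_of_nonneg_left hc_sq (sq_nonneg (D : ℝ))]
end
end

section
/- Let D ≥ 4 be an even integer and R ≥ 0 an integer. Every numerical wall datum (r,c,d,e) for (D,0,R) satisfies 6e/c ≤ (D−1)², i.e., every numerical wall at β = 0 for the Chern character (−R,0,D,0) satisfies α₀ = √(6e/c) ≤ D−1. -/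
noncomputable section

/-- If `x` is at most the squares of both `2 d` and `2 (D - d)`, and one of these two
nonnegative quantities is at most `M`, then `x ≤ M ^ 2`. -/
lemma le_sq_of_le_min {x d D M : ℝ} (hd : 0 < d) (hdD : d < D)
    (hx : x ≤ min (4 * d ^ 2) (4 * (D - d) ^ 2)) (hM : 2 * d ≤ M ∨ 2 * (D - d) ≤ M) :
    x ≤ M ^ 2 := by
  obtain ⟨h₁, h₂⟩ := le_min_iff.mp hx
  rcases hM with hM | hM
  · nlinarith
  · nlinarith

theorem stmt3 (D R : ℤ) (hD : 4 ≤ D) (heven : Even D) (hR : 0 ≤ R) (r c d e : ℝ)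
    (h : IsWallDatum D 0 R r c d e) :
    6 * e / c ≤ ((D : ℝ) - 1) ^ 2 := by
  obtain ⟨⟨a₀, a₁, a₂, a₃, ⟨-, ⟨n, hn⟩, ⟨m, hm⟩, -, -⟩, -, hc, hd, -⟩, hcpos, ⟨hd₀, hdD⟩,
    ⟨-, hmin⟩, -⟩ := h
  have hcn : c = n := by rw [hc, hn]; ring
  have hdm : d = m + (n : ℝ) ^ 2 / 2 := by rw [hd, ← hm, hn]; ring
  have hD' : (4 : ℝ) ≤ D := by exact_mod_cast hD
  have hn_pos : 0 < n := by
    rw [hcn] at hcpos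
    exact_mod_cast hcpos
  rw [div_le_iff₀ hcpos]
  obtain rfl | hn_two : n = 1 ∨ 2 ≤ n := by lia
  · obtain ⟨k, rfl⟩ := heven
    have hc_one : c = 1 := by simpa using hcn
    have key : 2 * d ≤ ((k + k : ℤ) : ℝ) - 1 ∨
        2 * (((k + k : ℤ) : ℝ) - d) ≤ ((k + k : ℤ) : ℝ) - 1 := by
      rw [hdm]
      push_cast
      rcases lt_or_ge m k with hmk | hmk
      · left
        have : (m : ℝ) + 1 ≤ k := by exact_mod_cast hmk
        linarith
      · right
        have : (k : ℝ) ≤ m := by exact_mod_cast hmk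
        linarith
    have := le_sq_of_le_min (by linarith) (by linarith) hmin key
    rw [hc_one] at this ⊢
    linarith
  · have hc_two : 2 ≤ c := by
      rw [hcn]
      exact_mod_cast hn_two
    have key : 2 * d ≤ (D : ℝ) ∨ 2 * ((D : ℝ) - d) ≤ D := by
      rcases le_total (2 * d) (D : ℝ) with h | h
      · exact Or.inl h
      · exact Or.inr (by linarith)
    have hsq := le_sq_of_le_min (by linarith) (by linarith) hmin key
    have hDc : (D : ℝ) ≤ ((D : ℝ) - 1) * c := by nlinarith
    have hDc_sq : (D : ℝ) ^ 2 ≤ (((D : ℝ) - 1) * c) ^ 2 := by gcongr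
    refine le_of_mul_le_mul_left ?_ hcpos
    calc c * (6 * e) ≤ (((D : ℝ) - 1) * c) ^ 2 := hsq.trans hDc_sq
      _ = c * (((D : ℝ) - 1) ^ 2 * c) := by ring
end
end

section
/- Let D ≥ 4 be an even integer and R ≥ 0 an integer. The set of values 6e/c over all numerical wall data (r,c,d,e) for (D,0,R) is nonempty and bounded above, and its supremum equals the supremum of the set of values 6e/c over all numerical wall data for (D−1,0,R). In particular, writing α_∞^D for the square root of this supremum (the largest numerical wall), one has α_∞^D = α_∞^{D−1} and D−2 < α_∞^D ≤ D−1. -/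
noncomputable section

/-- The set of values `6e/c` over all numerical wall data for `(D, 0, R)`. -/
def wallValues (D R : ℤ) : Set ℝ :=
  {x | ∃ r c d e : ℝ, IsWallDatum D 0 R r c d e ∧ x = 6 * e / c}

/-- The largest integer congruent to `1` modulo `6` that is at most `(D - 1) ^ 2`, for `D ≥ 4` even,
together with the bounds on it. -/
theorem exists_max_one_mod_six (D : ℤ) (hD : 4 ≤ D) (heven : Even D) :
    ∃ M : ℤ, M % 6 = 1 ∧ (D - 2) ^ 2 < M ∧ M ≤ (D - 1) ^ 2 ∧ D ^ 2 ≤ 4 * M ∧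
      ∀ E : ℤ, E % 6 = 1 → E ≤ (D - 1) ^ 2 → E ≤ M := by
  have hmod : (D - 1) ^ 2 % 6 = 1 ∨ (D - 1) ^ 2 % 6 = 3 := by
    have h6 : D % 6 = 0 ∨ D % 6 = 2 ∨ D % 6 = 4 := by
      have := Int.even_iff.mp heven
      omega
    rcases h6 with h | h | h <;> simp [pow_two, Int.mul_emod, Int.sub_emod, h]
  rcases hmod with h | h
  · exact ⟨(D - 1) ^ 2, h, by nlinarith, le_rfl, by nlinarith, fun E _ hE => hE⟩
  · exact ⟨(D - 1) ^ 2 - 2, by omega, by nlinarith, by omega, by nlinarith,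
      fun E h₁ h₂ => by omega⟩

/-- A wall datum of rank zero with `c = 1` realizing the wall value `M`. -/
theorem mem_wallValues (D K M R : ℤ) (hD : 4 ≤ D) (heven : Even D) (hR : 0 ≤ R)
    (hK : D - 1 ≤ K) (hM : M % 6 = 1) (hM0 : 0 < M) (hM1 : M ≤ (D - 1) ^ 2) :
    (M : ℝ) ∈ wallValues K R := by
  obtain ⟨t, ht⟩ : ∃ t, M = 6 * t + 1 := ⟨M / 6, by omega⟩
  obtain ⟨s, hs⟩ := heven
  have hD' : (4 : ℝ) ≤ D := by exact_mod_cast hD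
  have hR' : (0 : ℝ) ≤ R := by exact_mod_cast hR
  have hK' : (D : ℝ) - 1 ≤ K := by exact_mod_cast hK
  have hM0' : (0 : ℝ) < M := by exact_mod_cast hM0
  have hM1' : (M : ℝ) ≤ (D - 1) ^ 2 := by exact_mod_cast hM1
  have ht' : (M : ℝ) = 6 * t + 1 := by exact_mod_cast ht
  have hs' : (D : ℝ) = s + s := by exact_mod_cast hs
  refine ⟨0, 1, ((D : ℝ) - 1) / 2, (M : ℝ) / 6, ⟨⟨0, 1, ((D : ℝ) - 1) / 2, (M : ℝ) / 6, ⟨⟨0, ?_⟩,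
    ⟨1, ?_⟩, ⟨s - 1, ?_⟩, ⟨t, ?_⟩, ⟨2 * t - s + 1, ?_⟩⟩, ?_⟩, one_pos, ⟨?_, ?_⟩, ⟨?_, le_min ?_ ?_⟩,
    ?_, ?_⟩, ?_⟩
  · simp
  · simp
  · push_cast; linarith
  · linarith
  · push_cast; linarith
  · simp [IsTwist]
  · linarith
  · linarith
  · linarith
  · linarith
  · nlinarith
  · have : 0 ≤ 1 * (2 * (K : ℝ) - 2 * ((D - 1) / 2)) / (6 * (M / 6)) := by
      apply div_nonneg <;> linarith
    rw [neg_div]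
    linarith
  · apply div_nonneg <;> linarith
  · ring

theorem le_of_mem_wallValues (D K M R : ℤ) (heven : Even D)
    (hK : D - 1 ≤ K) (hKD : K ≤ D) (hM : D ^ 2 ≤ 4 * M)
    (hmax : ∀ E : ℤ, E % 6 = 1 → E ≤ (D - 1) ^ 2 → E ≤ M)
    {x : ℝ} (hx : x ∈ wallValues K R) : x ≤ M := by
  obtain ⟨r, c, d, e, ⟨⟨a₀, a₁, a₂, a₃, ⟨-, ⟨n, hn⟩, ⟨m, hm⟩, ⟨l, hl⟩, -⟩, -, hc, hd, he⟩, hc0,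
    ⟨hd0, hd1⟩, ⟨-, hN⟩, -⟩, rfl⟩ := hx
  obtain ⟨hN₁, hN₂⟩ := le_min_iff.mp hN
  obtain rfl : c = n := by rw [hc, hn]; ring
  obtain rfl : d = a₂ := by rw [hd]; ring
  obtain rfl : e = a₃ := by rw [he]; ring
  subst hn
  have hn0 : 0 < n := by exact_mod_cast hc0
  have hKD' : (K : ℝ) ≤ D := by exact_mod_cast hKD
  have hM' : (D : ℝ) ^ 2 ≤ 4 * M := by exact_mod_cast hM
  rw [div_le_iff₀ hc0]
  rcases (show n = 1 ∨ 2 ≤ n by omega) with rfl | hn2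
  · have h2d : 2 * d = ((2 * m + 1 : ℤ) : ℝ) := by push_cast at hm ⊢; linarith
    have h6e : 6 * e = ((6 * l + 1 : ℤ) : ℝ) := by push_cast at hl ⊢; linarith
    have hy0 : 0 < 2 * m + 1 := by rw [h2d] at hd0; exact_mod_cast hd0
    have hy1 : 2 * m + 1 < 2 * K := by rw [h2d] at hd1; exact_mod_cast hd1
    have hE₁ : 6 * l + 1 ≤ (2 * m + 1) ^ 2 := by
      have : ((6 * l + 1 : ℤ) : ℝ) ≤ ((2 * m + 1 : ℤ) : ℝ) ^ 2 := by
        rw [← h2d, ← h6e]; push_cast at hN₁; linarith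
      exact_mod_cast this
    have hE₂ : 6 * l + 1 ≤ (2 * K - (2 * m + 1)) ^ 2 := by
      have : ((6 * l + 1 : ℤ) : ℝ) ≤ (2 * K - ((2 * m + 1 : ℤ) : ℝ)) ^ 2 := by
        rw [← h2d, ← h6e]; push_cast at hN₂; linarith
      exact_mod_cast this
    have hE : 6 * l + 1 ≤ (D - 1) ^ 2 := by
      have hpar := Int.even_iff.mp heven
      rcases (show 2 * m + 1 ≤ D - 1 ∨ 2 * K - (2 * m + 1) ≤ D - 1 by omega) with h | h
      · exact hE₁.trans (pow_le_pow_left₀ (by omega) h 2)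
      · exact hE₂.trans (pow_le_pow_left₀ (by omega) h 2)
    rw [h6e]
    have hEM : ((6 * l + 1 : ℤ) : ℝ) ≤ M := Int.cast_le.mpr (hmax _ (by omega) hE)
    simpa using hEM
  · have hn2' : (2 : ℝ) ≤ n := by exact_mod_cast hn2
    have hle : (n : ℝ) * (6 * e) ≤ (D : ℝ) ^ 2 := by
      rcases le_total (2 * d) K with h | h
      · nlinarith
      · nlinarith
    have hM0 : (0 : ℝ) ≤ M := by nlinarith [sq_nonneg (D : ℝ)]
    have hMn : 4 * (M : ℝ) ≤ M * (n * n) := by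
      have hnn : (4 : ℝ) ≤ n * n := by nlinarith
      linarith [mul_le_mul_of_nonneg_left hnn hM0]
    refine le_of_mul_le_mul_left ?_ hc0
    linarith

theorem stmt4 (D R : ℤ) (hD : 4 ≤ D) (heven : Even D) (hR : 0 ≤ R) :
    (wallValues D R).Nonempty ∧ BddAbove (wallValues D R) ∧
      sSup (wallValues D R) = sSup (wallValues (D - 1) R) ∧
      (D : ℝ) - 2 < Real.sqrt (sSup (wallValues D R)) ∧
      Real.sqrt (sSup (wallValues D R)) ≤ (D : ℝ) - 1 := by
  obtain ⟨M, hM6, hlt, hle, hDM, hmax⟩ := exists_max_one_mod_six D hD heven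
  have hgreatest : ∀ K : ℤ, D - 1 ≤ K → K ≤ D → IsGreatest (wallValues K R) (M : ℝ) :=
    fun K h₁ h₂ => ⟨mem_wallValues D K M R hD heven hR h₁ hM6 (by nlinarith) hle,
      fun _ hx => le_of_mem_wallValues D K M R heven h₁ h₂ hDM hmax hx⟩
  have h₁ := hgreatest D (by omega) le_rfl
  have h₂ := hgreatest (D - 1) le_rfl (by omega)
  have hD' : (4 : ℝ) ≤ D := by exact_mod_cast hD
  refine ⟨h₁.nonempty, h₁.bddAbove, h₁.csSup_eq.trans h₂.csSup_eq.symm, ?_, ?_⟩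
  · rw [h₁.csSup_eq, Real.lt_sqrt (by linarith)]
    exact_mod_cast hlt
  · rw [h₁.csSup_eq, Real.sqrt_le_left (by linarith)]
    exact_mod_cast hle
end
end

section
/- Let D ≥ 1 and R ≥ 0 be integers. Then: (a) there exists a numerical wall datum (r,c,d,e) for (D,0,R) with √(6e/c) > D−2; and (b) every numerical wall datum (r,c,d,e) for (D,0,R) satisfies √(6e/c) ≤ D. Equivalently, the largest numerical wall α_∞^D := sup{√(6e/c) : (r,c,d,e) a numerical wall datum for (D,0,R)} satisfies D−2 < α_∞^D ≤ D. -/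
noncomputable section

/-- For odd `m = 2 * n + 1`, some integer congruent to `1` modulo `6` lies in `((m - 1)², m²]`. -/
lemma exists_one_add_six_mul_mem_Ioc (n : ℤ) (hn : 0 ≤ n) :
    ∃ k : ℤ, (2 * n) ^ 2 < 1 + 6 * k ∧ 1 + 6 * k ≤ (2 * n + 1) ^ 2 := by
  obtain ⟨j, rfl | rfl | rfl⟩ : ∃ j : ℤ, n = 3 * j ∨ n = 3 * j + 1 ∨ n = 3 * j + 2 :=
    ⟨n / 3, by omega⟩
  · exact ⟨6 * j ^ 2 + 2 * j, by nlinarith, by nlinarith⟩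
  · have hj : 0 ≤ j := by omega
    exact ⟨6 * j ^ 2 + 6 * j + 1, by nlinarith, by nlinarith⟩
  · exact ⟨6 * j ^ 2 + 10 * j + 4, by nlinarith, by nlinarith⟩

lemma exists_isWallDatum_lt_sqrt (D R : ℤ) (hD : 1 ≤ D) (hR : 0 ≤ R) :
    ∃ r c d e : ℝ, IsWallDatum D 0 R r c d e ∧ (D : ℝ) - 2 < Real.sqrt (6 * e / c) := by
  obtain ⟨n, hn, hnD, hDn⟩ : ∃ n : ℤ, 0 ≤ n ∧ 2 * n + 1 ≤ D ∧ D - 2 ≤ 2 * n :=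
    ⟨(D - 1) / 2, by omega, by omega, by omega⟩
  obtain ⟨k, hk1, hk2⟩ := exists_one_add_six_mul_mem_Ioc n hn
  rify at hn hnD hDn hk1 hk2 hR
  have hE : (0 : ℝ) < 1 + 6 * k := (sq_nonneg _).trans_lt hk1
  have h6 : 6 * ((1 + 6 * (k : ℝ)) / 6) = 1 + 6 * k := by ring
  refine ⟨0, 1, (2 * n + 1) / 2, (1 + 6 * k) / 6, ⟨⟨0, 1, (2 * n + 1) / 2, (1 + 6 * k) / 6,
    ⟨⟨0, by simp⟩, ⟨1, by simp⟩, ⟨n, by ring⟩, ⟨k, by ring⟩, ⟨2 * k - n, by push_cast; ring⟩⟩,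
    by simp, by simp, by simp, by simp⟩, one_pos, ⟨by linarith, by linarith⟩, ?_, ?_⟩, ?_⟩
  · rw [h6, one_mul]
    exact ⟨hE, le_min (by nlinarith) (by nlinarith)⟩
  · rw [h6, one_mul, one_mul, neg_div]
    have h1 : 0 ≤ (2 * (D : ℝ) - 2 * ((2 * n + 1) / 2)) / (1 + 6 * k) :=
      div_nonneg (by linarith) hE.le
    exact ⟨by linarith, by positivity⟩
  · rw [h6, div_one]
    exact hDn.trans_lt (Real.lt_sqrt_of_sq_lt hk1)

lemma IsWallDatum.sqrt_le {D R : ℤ} {r c d e : ℝ} (hD : 0 ≤ D)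
    (h : IsWallDatum D 0 R r c d e) : Real.sqrt (6 * e / c) ≤ D := by
  obtain ⟨⟨a₀, a₁, a₂, a₃, ⟨-, ⟨n, hn⟩, -⟩, -, hca, -⟩, hc, ⟨hd1, hd2⟩, ⟨-, hN2⟩, -⟩ := h
  obtain ⟨h1, h2⟩ := le_min_iff.mp hN2
  have hcn : c = n := by rw [hca, hn]; ring
  have hc1 : 1 ≤ c := by
    rw [hcn] at hc ⊢
    exact_mod_cast hc
  have hbound : c * (6 * e) ≤ (D : ℝ) ^ 2 := by
    rcases le_total (2 * d) D with hd | hd <;> nlinarith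
  refine Real.sqrt_le_iff.mpr ⟨by exact_mod_cast hD, (div_le_iff₀ hc).mpr ?_⟩
  refine le_of_mul_le_mul_left (hbound.trans ?_) hc
  nlinarith [mul_nonneg (sq_nonneg (D : ℝ)) (mul_nonneg (sub_nonneg.mpr hc1) (by linarith : 0 ≤ c + 1))]

theorem stmt5 (D R : ℤ) (hD : 1 ≤ D) (hR : 0 ≤ R) :
    (∃ r c d e : ℝ, IsWallDatum D 0 R r c d e ∧ (D : ℝ) - 2 < Real.sqrt (6 * e / c)) ∧
      (∀ r c d e : ℝ, IsWallDatum D 0 R r c d e → Real.sqrt (6 * e / c) ≤ (D : ℝ)) := by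
  exact ⟨exists_isWallDatum_lt_sqrt D R hD hR, fun _ _ _ _ h => h.sqrt_le (by omega)⟩
end
end

section
/- Let D ≥ 1 be an integer and β a real number. Every numerical wall datum (r,c,d,e) for (D,β,0) with 6e/c > 2D satisfies r = 0. (Hence every wall for the β-twisted Chern character (0,0,D,0) lying in the region (s+1/6)α² > D/3 of the (α,s)-slice comes from a destabilizing object of rank 0.) -/
noncomputable section

theorem stmt7 (D : ℤ) (hD : 1 ≤ D) (β : ℝ) (r c d e : ℝ)
    (h : IsWallDatum D β 0 r c d e) (hgt : 2 * (D : ℝ) < 6 * e / c) :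
    r = 0 := by
  obtain ⟨⟨a₀, a₁, a₂, a₃, ⟨⟨n, hn⟩, -⟩, hr, -⟩, hc, ⟨hd, hdD⟩, -, hlo, hhi⟩ := h
  rw [lt_div_iff₀ hc] at hgt
  have he : 0 < 6 * e := lt_trans (mul_pos (hd.trans hdD) hc) hgt
  have hupper : c * (2 * d) / (6 * e) < 1 := by
    rw [div_lt_one he]
    nlinarith
  have hlower : -1 < -(c * (2 * (D : ℝ) - 2 * d)) / (6 * e) := by
    rw [lt_div_iff₀ he]
    nlinarith
  rw [Int.cast_zero, sub_zero] at hlo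
  have hrn : r = n := hr.trans hn
  have hn_lt : n < 1 := by exact_mod_cast hrn ▸ hhi.trans_lt hupper
  have hn_gt : -1 < n := by exact_mod_cast hrn ▸ hlower.trans_le hlo
  have hn_zero : n = 0 := by lia
  rw [hrn, hn_zero, Int.cast_zero]
end
end

section
/- Let D ≥ 1 and R ≥ 0 be integers, and set m = ⌈D/2⌉. Then the quadruple (0, 1, m − 1/2, (3m² − 3m + 1)/6), which is the Chern character of the twisted structure sheaf O_H(m) of a plane H ⊂ ℙ³, is a numerical wall datum for (D,0,R). In particular α₀² = 3m² − 3m + 1 is always a numerical wall for the Chern character (−R,0,D,0) at β = 0. -/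
noncomputable section

/-- The triple `(1, m - 1/2, m²/2 - m/2 + 1/6)` in rank zero, the Chern character of
`O_H(m)` for a plane `H`, satisfies the integrality constraints. -/
lemma isP3Char_plane (m : ℤ) :
    IsP3Char 0 1 ((m : ℝ) - 1 / 2) ((3 * (m : ℝ) ^ 2 - 3 * (m : ℝ) + 1) / 6) := by
  refine ⟨⟨0, by simp⟩, ⟨1, by simp⟩, ⟨m - 1, by push_cast; ring⟩, ?_,
    ⟨(m - 1) ^ 2, by push_cast; ring⟩⟩
  obtain ⟨k, hk⟩ := Int.even_mul_pred_self m
  have hk' : (m : ℝ) * (m - 1) = k + k := by exact_mod_cast hk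
  exact ⟨k, by linear_combination hk' / 2⟩

lemma isTwist_zero (r c d e : ℝ) : IsTwist 0 r c d e r c d e := by
  refine ⟨rfl, ?_, ?_, ?_⟩ <;> ring

/-- The Chern character of `O_H(m)` is a wall datum at `β = 0` whenever
`2m - 1 ≤ D` and `1 ≤ m`. -/
lemma isWallDatum_plane {D R m : ℤ} (hR : 0 ≤ R) (hm : 1 ≤ m) (hD : 2 * m - 1 ≤ D) :
    IsWallDatum D 0 R 0 1 ((m : ℝ) - 1 / 2) ((3 * (m : ℝ) ^ 2 - 3 * (m : ℝ) + 1) / 6) := by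
  have hR' : (0 : ℝ) ≤ R := by exact_mod_cast hR
  have hm' : (1 : ℝ) ≤ m := by exact_mod_cast hm
  have hD' : 2 * (m : ℝ) - 1 ≤ D := by exact_mod_cast hD
  have he : 0 < 6 * ((3 * (m : ℝ) ^ 2 - 3 * (m : ℝ) + 1) / 6) := by nlinarith
  refine ⟨⟨_, _, _, _, isP3Char_plane m, isTwist_zero _ _ _ _⟩, one_pos,
    ⟨by linarith, by linarith⟩, ⟨by linarith, le_min (by nlinarith) ?_⟩, ?_, ?_⟩
  · have h : (2 * (m : ℝ) - 1) ^ 2 ≤ (2 * (D - (m - 1 / 2))) ^ 2 :=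
      pow_le_pow_left₀ (by linarith) (by linarith) 2
    nlinarith
  · have h : -(1 * (2 * (D : ℝ) - 2 * (m - 1 / 2))) /
        (6 * ((3 * (m : ℝ) ^ 2 - 3 * (m : ℝ) + 1) / 6)) ≤ 0 :=
      div_nonpos_of_nonpos_of_nonneg (by linarith) he.le
    linarith
  · exact div_nonneg (by linarith) he.le

theorem stmt8 (D R : ℤ) (hD : 1 ≤ D) (hR : 0 ≤ R) :
    IsWallDatum D 0 R 0 1 ((⌈(D : ℚ) / 2⌉ : ℝ) - 1 / 2)
      ((3 * (⌈(D : ℚ) / 2⌉ : ℝ) ^ 2 - 3 * (⌈(D : ℚ) / 2⌉ : ℝ) + 1) / 6) := by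
  have hD' : (1 : ℚ) ≤ D := by exact_mod_cast hD
  refine isWallDatum_plane hR (Int.one_le_ceil_iff.2 (by linarith)) ?_
  have h : 2 * (⌈(D : ℚ) / 2⌉ : ℚ) < D + 2 := by linarith [Int.ceil_lt_add_one ((D : ℚ) / 2)]
  have h' : 2 * ⌈(D : ℚ) / 2⌉ < D + 2 := by exact_mod_cast h
  omega
end
end

section
/- The set of values 6e/c, as (r,c,d,e) ranges over all numerical wall data for (3,0,0) with 6e/c ≥ 1, is exactly {1, 7}. In other words, for the Chern character (0,0,3,0) at β = 0, the numerical walls α₀ ≥ 1 are precisely α₀ = 1 and α₀ = √7. -/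
noncomputable section

/-- An integer pair `c > 0`, `w = c + 6k` with `w ≥ c` and `cw ≤ 9` has `w = c` or `w = 7c`. -/
lemma eq_or_eq_seven_mul_of_mul_le_nine {c k : ℤ} (hc : 0 < c) (hk : 0 ≤ k)
    (h : c * (c + 6 * k) ≤ 9) : k = 0 ∨ k = c := by
  have hc3 : c ≤ 3 := by nlinarith [mul_nonneg hc.le hk]
  interval_cases c <;> omega

/-- The rank-zero quadruple `(0, 1, 3/2, e)` with `6e = 1 + 6k ∈ {1, 7}` is a wall datum. -/
lemma isWallDatum_rank_zero (k : ℤ) (hk : 0 ≤ k) (hk' : k ≤ 1) :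
    IsWallDatum 3 0 0 0 1 (3 / 2) (1 / 6 + k) := by
  have h0 : (0 : ℝ) ≤ k := by exact_mod_cast hk
  have h1 : (k : ℝ) ≤ 1 := by exact_mod_cast hk'
  have hpos : (0 : ℝ) < 6 * (1 / 6 + k) := by linarith
  refine ⟨⟨0, 1, 3 / 2, 1 / 6 + k, ⟨⟨0, by norm_num⟩, ⟨1, by norm_num⟩, ⟨1, by norm_num⟩,
    ⟨k, by ring⟩, ⟨2 * k - 1, by push_cast; ring⟩⟩, by norm_num [IsTwist]⟩, by norm_num,
    by norm_num, ⟨by linarith, le_min ?_ ?_⟩, ?_, by positivity⟩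
  · linarith
  · norm_num
    linarith
  · have : 0 ≤ (1 * (2 * ((3 : ℤ) : ℝ) - 2 * (3 / 2))) / (6 * (1 / 6 + (k : ℝ))) :=
      div_nonneg (by norm_num) hpos.le
    rw [neg_div]
    push_cast at this ⊢
    linarith

theorem stmt12 :
    {x : ℝ | (∃ r c d e : ℝ, IsWallDatum 3 0 0 r c d e ∧ x = 6 * e / c) ∧ 1 ≤ x}
      = ({1, 7} : Set ℝ) := by
  ext x
  simp only [Set.mem_ofPred_eq, Set.mem_insert_iff, Set.mem_singleton_iff]
  constructor
  · rintro ⟨⟨r, c, d, e, ⟨⟨a₀, a₁, a₂, a₃, ⟨-, ⟨m, hm⟩, -, ⟨k, hk⟩, -⟩, -, hca, -, hea⟩,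
      hc, hd, ⟨-, hce⟩, -⟩, rfl⟩, hx⟩
    obtain rfl : c = m := by linarith
    obtain rfl : e = m / 6 + k := by
      rw [hm] at hk
      norm_num at hea
      linarith
    rw [le_div_iff₀ hc] at hx
    obtain ⟨h₁, h₂⟩ := le_min_iff.mp hce
    push_cast at h₁ h₂ hd
    have h9 : (m : ℝ) * (m + 6 * k) ≤ 9 := by
      rcases le_total d (3 / 2) with h | h <;> nlinarith
    rcases eq_or_eq_seven_mul_of_mul_le_nine (c := m) (k := k) (by exact_mod_cast hc)
      (by have : (0 : ℝ) ≤ k := by linarith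
          exact_mod_cast this) (by exact_mod_cast h9) with rfl | rfl
    · left
      field_simp
      norm_num
    · right
      field_simp
      norm_num
  · rintro (rfl | rfl)
    · exact ⟨⟨_, _, _, _, isWallDatum_rank_zero 0 le_rfl zero_le_one, by norm_num⟩, le_rfl⟩
    · exact ⟨⟨_, _, _, _, isWallDatum_rank_zero 1 zero_le_one le_rfl, by norm_num⟩, by norm_num⟩
end
end

section
/- The set of values 6e/c, as (r,c,d,e) ranges over all numerical wall data for (4,0,0) with 6e/c ≥ 1, is exactly {1, 4, 7}. In other words, for the Chern character (0,0,4,0) at β = 0, the numerical walls α₀ ≥ 1 are precisely α₀ = 1 (the killing wall), α₀ = 2 (the elliptical wall) and α₀ = √7 (the planar wall). -/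
noncomputable section

/-- A wall datum at `β = 0` with `6e/c ≥ 1` has `6e = c + 6k` and `2d = 2j + c²` for integers
`j, k`; the bound (N2) for `D = 4` then leaves finitely many cases. -/
theorem wall_arith {c j k : ℤ} (hc : 0 < c) (hk : 0 ≤ k)
    (hd0 : 0 < 2 * j + c ^ 2) (hd8 : 2 * j + c ^ 2 < 8)
    (h₁ : c * (6 * k + c) ≤ (2 * j + c ^ 2) ^ 2)
    (h₂ : c * (6 * k + c) ≤ (8 - (2 * j + c ^ 2)) ^ 2) :
    k = 0 ∨ (c = 1 ∧ k = 1) ∨ (c = 2 ∧ k = 1) := by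
  obtain ⟨m, hm⟩ : ∃ m, m = 2 * j + c ^ 2 := ⟨_, rfl⟩
  rw [← hm] at hd0 hd8 h₁ h₂
  have h16 : c * (6 * k + c) ≤ 16 := by
    rcases le_total m 4 with h | h <;> nlinarith
  have hc4 : c ≤ 4 := by nlinarith [mul_nonneg hc.le hk]
  interval_cases c <;> interval_cases m <;> omega

theorem stmt13 :
    {x : ℝ | (∃ r c d e : ℝ, IsWallDatum 4 0 0 r c d e ∧ x = 6 * e / c) ∧ 1 ≤ x}
      = ({1, 4, 7} : Set ℝ) := by
  ext x
  simp only [Set.mem_ofPred_eq, Set.mem_insert_iff, Set.mem_singleton_iff]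
  constructor
  · rintro ⟨⟨r, c, d, e, ⟨⟨a₀, a₁, a₂, a₃, ⟨-, ⟨c', rfl⟩, ⟨j, hj⟩, ⟨k, hk⟩, -⟩, -, hc, hd, he⟩,
      hc0, ⟨hd0, hd8⟩, ⟨-, hmin⟩, -⟩, rfl⟩, hx⟩
    obtain rfl : c = c' := by linarith
    obtain rfl : d = j + (c' : ℝ) ^ 2 / 2 := by linarith
    obtain rfl : e = k + (c' : ℝ) / 6 := by linarith
    obtain ⟨h₁, h₂⟩ := le_min_iff.mp hmin
    have hk0 : (0 : ℝ) ≤ k := by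
      rw [le_div_iff₀ hc0] at hx
      linarith
    push_cast at hd8 h₂
    have key : k = 0 ∨ (c' = 1 ∧ k = 1) ∨ (c' = 2 ∧ k = 1) := by
      refine wall_arith (j := j) (by exact_mod_cast hc0) (by exact_mod_cast hk0) ?_ ?_ ?_ ?_
      · rify; linarith
      · rify; linarith
      · rify; linarith
      · rify; linarith
    rcases key with rfl | ⟨rfl, rfl⟩ | ⟨rfl, rfl⟩
    · left
      field_simp
      norm_num
    · norm_num
    · norm_num
  · have mem : ∀ c d e : ℝ, IsP3Char 0 c d e → 0 < c → 0 < d → d < 4 → 0 < e →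
        c * (6 * e) ≤ 4 * d ^ 2 → c * (6 * e) ≤ 4 * (4 - d) ^ 2 → IsWallDatum 4 0 0 0 c d e := by
      intro c d e hch hc hd hd4 he h₁ h₂
      have hneg : 0 ≤ c * (2 * 4 - 2 * d) / (6 * e) :=
        div_nonneg (mul_nonneg hc.le (by linarith)) (by linarith)
      refine ⟨⟨0, c, d, e, hch, rfl, by ring, by ring, by ring⟩, hc, ⟨by linarith, ?_⟩,
        ⟨by positivity, le_min h₁ ?_⟩, ?_, by positivity⟩
      · push_cast; linarith
      · push_cast; exact h₂
      · push_cast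
        rw [neg_div]
        linarith
    rintro (rfl | rfl | rfl)
    · refine ⟨⟨0, 1, 3 / 2, 1 / 6, mem _ _ _ ⟨⟨0, ?_⟩, ⟨1, ?_⟩, ⟨1, ?_⟩, ⟨0, ?_⟩, ⟨-1, ?_⟩⟩
        ?_ ?_ ?_ ?_ ?_ ?_, ?_⟩, ?_⟩ <;> norm_num
    · refine ⟨⟨0, 2, 2, 4 / 3, mem _ _ _ ⟨⟨0, ?_⟩, ⟨2, ?_⟩, ⟨0, ?_⟩, ⟨1, ?_⟩, ⟨0, ?_⟩⟩
        ?_ ?_ ?_ ?_ ?_ ?_, ?_⟩, ?_⟩ <;> norm_num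
    · refine ⟨⟨0, 1, 3 / 2, 7 / 6, mem _ _ _ ⟨⟨0, ?_⟩, ⟨1, ?_⟩, ⟨1, ?_⟩, ⟨1, ?_⟩, ⟨1, ?_⟩⟩
        ?_ ?_ ?_ ?_ ?_ ?_, ?_⟩, ?_⟩ <;> norm_num
end
end
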